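/- arXiv:2203.00095 — 9 statements merged into one kernel-verified Lean document; each statement's English description precedes it below -/
import Mathlib

section
/- Let a finite set of N workers be partitioned into categories C_0, C_1, ..., C_k with |C_r| = N_r, let 1 ≤ n ≤ N, fix a category index ℓ and an integer i with 1 ≤ i ≤ n, and define a_{i,ℓ} as the coefficient of x^{n-i} in ∏_{r=0, r≠ℓ}^{k} ( ∑_{j=0}^{i-1} C(N_r, j) x^j ). Then the number of n-element subsets G of the workers such that |G ∩ C_ℓ| = i and |G ∩ C_r| ≤ i−1 for every r ≠ ℓ (i.e., category ℓ is the strict mode of G with count exactly i) equals C(N_ℓ, i) · a_{i,ℓ}. -/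
open Finset Polynomial

/-- The generating function, by size, of the subsets of `α` whose number of elements in the
fibre of `f` over `r` lies in `A r` for every `r`. -/
theorem sum_X_pow_card_filter_fiber_card_mem {α β : Type*} [Fintype α] [DecidableEq α]
    [Fintype β] [DecidableEq β] (f : α → β) (A : β → Finset ℕ) :
    ∑ G : Finset α with ∀ r, #{w ∈ G | f w = r} ∈ A r, (X : ℕ[X]) ^ #G =
      ∏ r, ∑ j ∈ A r, Polynomial.C ((#{w | f w = r}).choose j) * X ^ j := by
  have factor (r : β) : ∑ j ∈ A r, Polynomial.C ((#{w | f w = r}).choose j) * X ^ j =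
      ∑ B ∈ (univ.filter fun w => f w = r).powerset with #B ∈ A r, (X : ℕ[X]) ^ #B := by
    rw [← Finset.sum_fiberwise_of_maps_to (t := A r) (g := fun B => #B) (by simp)]
    refine Finset.sum_congr rfl fun j hj => ?_
    rw [Finset.sum_congr (g := fun _ => (X : ℕ[X]) ^ j) rfl
      (fun B hB => by rw [(Finset.mem_filter.1 hB).2]), Finset.sum_const, nsmul_eq_mul,
      ← Finset.card_powersetCard, ← Polynomial.C_eq_natCast, Nat.cast_id]
    congr 3
    ext B
    simp only [mem_powersetCard, mem_filter, mem_powerset]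
    grind
  simp_rw [factor]
  rw [Finset.prod_univ_sum]
  refine Finset.sum_bij' (fun G _ r => {w ∈ G | f w = r}) (fun x _ => univ.filter fun w => w ∈ x (f w))
    ?_ ?_ ?_ ?_ ?_
  · intro G hG
    simp only [mem_filter, mem_univ, true_and] at hG
    simp only [Fintype.mem_piFinset, mem_filter, mem_powerset]
    exact fun r => ⟨Finset.filter_subset_filter _ (Finset.subset_univ _), hG r⟩
  · intro x hx
    simp only [Fintype.mem_piFinset, mem_filter, mem_powerset] at hx
    simp only [mem_filter, mem_univ, true_and]
    intro r
    convert (hx r).2 using 2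
    ext w
    have := @(hx r).1 w
    grind
  · intro G hG
    ext w
    simp
  · intro x hx
    simp only [Fintype.mem_piFinset, mem_filter, mem_powerset] at hx
    ext r w
    have := @(hx r).1 w
    grind
  · intro G hG
    rw [Finset.prod_pow_eq_pow_sum,
      ← Finset.card_eq_sum_card_fiberwise (f := f) (t := univ) (by simp)]

/-- Workers are the elements of `Fin N`, partitioned into categories
`C_0, …, C_k` via `cat : Fin N → Fin (k+1)`.  For `1 ≤ i ≤ n`, the number of `n`-element
subsets `G` of the workers such that `|G ∩ C_ℓ| = i` and `|G ∩ C_r| ≤ i - 1` (i.e. `< i`)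
for every `r ≠ ℓ` — category `ℓ` is the strict mode of `G` with count exactly `i` —
equals `C(N_ℓ, i) · a_{i,ℓ}`, where `a_{i,ℓ}` is the coefficient of `x^(n-i)` in
`∏_{r ≠ ℓ} (∑_{j=0}^{i-1} C(N_r, j) x^j)`. -/
theorem card_strict_mode_count_eq
    (N k n i : ℕ) (hn : 1 ≤ n) (hnN : n ≤ N) (hi1 : 1 ≤ i) (hin : i ≤ n)
    (cat : Fin N → Fin (k + 1)) (ℓ : Fin (k + 1)) :
    (((Finset.univ : Finset (Fin N)).powersetCard n).filter fun G =>
        (G.filter fun w => cat w = ℓ).card = i ∧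
        ∀ r : Fin (k + 1), r ≠ ℓ → (G.filter fun w => cat w = r).card < i).card
      =
    ((Finset.univ.filter fun w => cat w = ℓ)).card.choose i *
      (∏ r ∈ Finset.univ.erase ℓ,
          ∑ j ∈ Finset.range i,
            (Polynomial.C (((Finset.univ.filter fun w => cat w = r)).card.choose j)
              * X ^ j : Polynomial ℕ)).coeff (n - i) := by
  have key := congrArg (fun p => coeff p n) (sum_X_pow_card_filter_fiber_card_mem cat
    fun r => if r = ℓ then {i} else Finset.range i)
  rw [← Finset.mul_prod_erase univ _ (mem_univ ℓ)] at key
  simp only [if_true, Finset.sum_singleton, mul_assoc, coeff_C_mul, coeff_X_pow_mul', if_pos hin,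
    finsetSum_coeff, coeff_X_pow, Finset.sum_boole, Finset.filter_filter, Nat.cast_id] at key
  rw [Finset.prod_congr rfl fun r hr => by rw [if_neg (Finset.ne_of_mem_erase hr)]] at key
  rw [← key]
  congr 1
  ext G
  simp only [mem_filter, mem_powersetCard, subset_univ, true_and, mem_univ]
  refine ⟨fun ⟨hG, hℓ, h⟩ => ⟨fun r => ?_, hG.symm⟩, fun ⟨h, hG⟩ => ⟨hG.symm, ?_, fun r hr => ?_⟩⟩
  · split_ifs with hr
    · simpa [hr] using hℓ
    · simpa using h r hr
  · simpa using h ℓ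
  · simpa [hr] using h r
end

section
/- Let a finite set of N workers be partitioned into categories C_0, C_1, ..., C_k with |C_r| = N_r, let 1 ≤ n ≤ N, let i_0 be an integer with 1 ≤ i_0 ≤ n, and let an n-element subset G of the workers be chosen uniformly at random among all C(N, n) such subsets. Then the probability that category ℓ is the strict mode of G with count at least i_0 (i.e., there exists i ≥ i_0 with |G ∩ C_ℓ| = i and |G ∩ C_r| ≤ i−1 for all r ≠ ℓ) equals q̂_ℓ = ( ∑_{i=i_0}^{n} C(N_ℓ, i) · a_{i,ℓ} ) / C(N, n), where a_{i,ℓ} is the coefficient of x^{n-i} in ∏_{r≠ℓ} ∑_{j=0}^{i-1} C(N_r, j) x^j. -/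
open Finset Polynomial
open scoped Classical

lemma sum_choose_mul_X_pow_eq_sum_powerset {α : Type*} (T : Finset α) (S : Finset ℕ) :
    ∑ j ∈ S, (Polynomial.C (T.card.choose j) * X ^ j : Polynomial ℕ) =
      ∑ A ∈ T.powerset with A.card ∈ S, X ^ A.card := by
  rw [← Finset.sum_fiberwise_of_maps_to (t := S) (g := Finset.card)
    (fun A hA => (Finset.mem_filter.1 hA).2)]
  refine Finset.sum_congr rfl fun j hj => ?_
  have h : (T.powerset.filter fun A => A.card ∈ S).filter (fun A => A.card = j) =
      T.powersetCard j := by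
    ext A
    simp only [Finset.mem_filter, Finset.mem_powerset, Finset.mem_powersetCard]
    constructor
    · rintro ⟨⟨h1, -⟩, h2⟩
      exact ⟨h1, h2⟩
    · rintro ⟨h1, h2⟩
      exact ⟨⟨h1, h2 ▸ hj⟩, h2⟩
  rw [h, Finset.sum_congr rfl fun A hA => by rw [(Finset.mem_powersetCard.1 hA).2],
    Finset.sum_const, Finset.card_powersetCard, nsmul_eq_mul, ← Polynomial.C_eq_natCast, Nat.cast_id]

/-- The subsets of prescribed size whose intersection with each colour class has an allowed
cardinality are counted by a coefficient of a product of truncated binomial polynomials. -/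
lemma card_filter_card_fiber_mem_eq_coeff {α ι : Type*} [Fintype α] [Fintype ι] [DecidableEq ι]
    (c : α → ι) (S : ι → Finset ℕ) (n : ℕ) :
    (((Finset.univ : Finset α).powersetCard n).filter fun G =>
        ∀ r, (G.filter fun w => c w = r).card ∈ S r).card =
      (∏ r, ∑ j ∈ S r, (Polynomial.C ((Finset.univ.filter fun w => c w = r).card.choose j) * X ^ j :
        Polynomial ℕ)).coeff n := by
  simp_rw [sum_choose_mul_X_pow_eq_sum_powerset]
  rw [Finset.prod_univ_sum, Polynomial.finsetSum_coeff]
  simp_rw [Finset.prod_pow_eq_pow_sum, Polynomial.coeff_X_pow]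
  rw [← Finset.card_filter]
  have hfib {A : ι → Finset α} (hA : ∀ r, A r ⊆ Finset.univ.filter fun w => c w = r) (r : ι) :
      (Finset.univ.biUnion A).filter (fun w => c w = r) = A r := by
    ext w
    simp only [Finset.mem_filter, Finset.mem_biUnion, Finset.mem_univ, true_and]
    constructor
    · rintro ⟨⟨s, hs⟩, rfl⟩
      rwa [(Finset.mem_filter.1 (hA s hs)).2]
    · exact fun h => ⟨⟨r, h⟩, (Finset.mem_filter.1 (hA r h)).2⟩
  have hcard (G : Finset α) : G.card = ∑ r, (G.filter fun w => c w = r).card :=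
    Finset.card_eq_sum_card_fiberwise fun _ _ => Finset.mem_coe.2 (Finset.mem_univ _)
  refine Finset.card_nbij' (fun G r => G.filter fun w => c w = r)
    (fun A => Finset.univ.biUnion A) ?_ ?_ ?_ ?_
  · intro G hG
    simp only [Finset.coe_filter, Finset.mem_powersetCard, Set.mem_ofPred_eq] at hG
    simp only [Finset.coe_filter, Fintype.mem_piFinset, Finset.mem_filter, Finset.mem_powerset,
      Set.mem_ofPred_eq]
    exact ⟨fun r => ⟨Finset.filter_subset_filter _ hG.1.1, hG.2 r⟩, by rw [← hcard, hG.1.2]⟩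
  · intro A hA
    simp only [Finset.coe_filter, Fintype.mem_piFinset, Finset.mem_filter, Finset.mem_powerset,
      Set.mem_ofPred_eq] at hA
    have h := hfib fun r => (hA.1 r).1
    simp only [Finset.coe_filter, Finset.mem_powersetCard, Set.mem_ofPred_eq]
    refine ⟨⟨Finset.subset_univ _, ?_⟩, fun r => ?_⟩
    · rw [hcard, hA.2]
      simp_rw [h]
    · rw [h]
      exact (hA.1 r).2
  · intro G _
    ext w
    simp
  · intro A hA
    simp only [Finset.coe_filter, Fintype.mem_piFinset, Finset.mem_filter, Finset.mem_powerset,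
      Set.mem_ofPred_eq] at hA
    exact funext (hfib fun r => (hA.1 r).1)

/-- The number of `n`-element subsets in which colour `l` has exactly `i` elements and every other
colour has fewer. -/
lemma card_filter_strict_mode_eq {α ι : Type*} [Fintype α] [Fintype ι] [DecidableEq ι]
    (c : α → ι) (l : ι) {i n : ℕ} (hi : i ≤ n) :
    (((Finset.univ : Finset α).powersetCard n).filter fun G =>
        (G.filter fun w => c w = l).card = i ∧
          ∀ r, r ≠ l → (G.filter fun w => c w = r).card < i).card =
      (Finset.univ.filter fun w => c w = l).card.choose i *
        (∏ r ∈ Finset.univ.erase l, ∑ j ∈ Finset.range i,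
          (Polynomial.C ((Finset.univ.filter fun w => c w = r).card.choose j) * X ^ j :
            Polynomial ℕ)).coeff (n - i) := by
  have h := card_filter_card_fiber_mem_eq_coeff c
    (fun r => if r = l then {i} else Finset.range i) n
  rw [← Finset.mul_prod_erase _ _ (Finset.mem_univ l), if_pos rfl, Finset.sum_singleton,
    mul_assoc, Polynomial.coeff_C_mul, Polynomial.coeff_X_pow_mul', if_pos hi,
    Finset.prod_congr rfl fun r hr => by rw [if_neg (Finset.ne_of_mem_erase hr)]] at h
  rw [← h]
  congr 1
  refine Finset.filter_congr fun G _ => ⟨fun hG r => ?_, fun hG => ⟨?_, fun r hr => ?_⟩⟩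
  · by_cases hr : r = l
    · subst hr
      simpa using hG.1
    · simpa [hr] using hG.2 r hr
  · simpa using hG l
  · simpa [hr] using hG r

/-- Workers are the elements of `Fin N`, partitioned into categories via
`cat : Fin N → Fin (k+1)`.  An `n`-element subset `G` is chosen uniformly at random among
all `C(N, n)` such subsets.  The probability that category `ℓ` is the strict mode of `G`
with count at least `i₀` (there exists `i ≥ i₀` with `|G ∩ C_ℓ| = i` and `|G ∩ C_r| ≤ i-1`,
i.e. `< i`, for all `r ≠ ℓ`) equals
`q̂_ℓ = (∑_{i=i₀}^{n} C(N_ℓ, i) · a_{i,ℓ}) / C(N, n)`,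
where `a_{i,ℓ}` is the coefficient of `x^(n-i)` in `∏_{r ≠ ℓ} ∑_{j=0}^{i-1} C(N_r, j) x^j`. -/
theorem prob_strict_mode_eq
    (N k n i₀ : ℕ) (hn : 1 ≤ n) (hnN : n ≤ N) (hi₀1 : 1 ≤ i₀) (hi₀n : i₀ ≤ n)
    (cat : Fin N → Fin (k + 1)) (ℓ : Fin (k + 1)) :
    ((((Finset.univ : Finset (Fin N)).powersetCard n).filter fun G =>
        ∃ i, i₀ ≤ i ∧ (G.filter fun w => cat w = ℓ).card = i ∧
          ∀ r : Fin (k + 1), r ≠ ℓ → (G.filter fun w => cat w = r).card < i).card : ℚ)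
      / (N.choose n)
      =
    (∑ i ∈ Finset.Icc i₀ n,
        (((Finset.univ.filter fun w => cat w = ℓ)).card.choose i *
          (∏ r ∈ Finset.univ.erase ℓ,
              ∑ j ∈ Finset.range i,
                (Polynomial.C (((Finset.univ.filter fun w => cat w = r)).card.choose j)
                  * X ^ j : Polynomial ℕ)).coeff (n - i) : ℚ))
      / (N.choose n) := by
  congr 1
  norm_cast
  rw [Finset.card_eq_sum_card_fiberwise (t := Finset.Icc i₀ n)
    (f := fun G => (G.filter fun w => cat w = ℓ).card)]
  · refine Finset.sum_congr rfl fun i hi => ?_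
    rw [Finset.mem_Icc] at hi
    rw [← card_filter_strict_mode_eq cat ℓ hi.2, Finset.filter_filter]
    congr 1
    ext G
    simp only [Finset.mem_filter]
    refine and_congr_right fun _ => ⟨?_, fun h => ⟨⟨i, hi.1, h⟩, h.1⟩⟩
    rintro ⟨⟨j, -, rfl, h⟩, rfl⟩
    exact ⟨rfl, h⟩
  · intro G hG
    simp only [Finset.coe_filter, Finset.mem_powersetCard, Set.mem_ofPred_eq] at hG
    obtain ⟨⟨-, hGn⟩, j, hj, rfl, -⟩ := hG
    exact Finset.mem_coe.2 (Finset.mem_Icc.2 ⟨hj, hGn ▸ Finset.card_filter_le _ _⟩)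
end

section
/- Let a finite set of N workers be partitioned into categories C_0, C_1, ..., C_k with |C_r| = N_r, let 1 ≤ n ≤ N, and let i_0 be an integer with 1 ≤ i_0 ≤ n. For an n-element subset G chosen uniformly at random, the events E_ℓ = { category ℓ is the strict mode of G with count at least i_0 } for ℓ = 0, 1, ..., k are pairwise disjoint, and hence the probability q that some category is a strict mode with count at least i_0 equals the sum q = ∑_{ℓ=0}^{k} q̂_ℓ = ∑_{i=i_0}^{n} ∑_{ℓ=0}^{k} C(N_ℓ, i) a_{i,ℓ} / C(N, n), where a_{i,ℓ} is the coefficient of x^{n-i} in ∏_{r≠ℓ} ∑_{j=0}^{i-1} C(N_r, j) x^j. -/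
open Finset Polynomial
open scoped Classical

/-- Generating function of the finsets whose part of each colour `r` has size in `S r`. -/
theorem prod_sum_choose_mul_X_pow {α ι : Type*} [Fintype α] [Fintype ι] [DecidableEq ι]
    (c : α → ι) (S : ι → Finset ℕ) :
    ∏ r, ∑ j ∈ S r, (Polynomial.C ((univ.filter fun w => c w = r).card.choose j) * X ^ j : ℕ[X]) =
      ∑ G : Finset α with ∀ r, (G.filter fun w => c w = r).card ∈ S r, X ^ G.card := by
  have fiber (r : ι) :
      ∑ j ∈ S r, (Polynomial.C ((univ.filter fun w => c w = r).card.choose j) * X ^ j : ℕ[X]) =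
        ∑ T ∈ (univ.filter fun w => c w = r).powerset with T.card ∈ S r, X ^ T.card := by
    rw [← sum_fiberwise_of_maps_to (s := {T ∈ (univ.filter fun w => c w = r).powerset |
      T.card ∈ S r}) (t := S r) (g := card) (by simp)]
    refine sum_congr rfl fun j hj => ?_
    have h : (((univ.filter fun w => c w = r).powerset.filter fun T => T.card ∈ S r).filter
        fun T => T.card = j) = (univ.filter fun w => c w = r).powersetCard j := by
      ext T
      simp only [mem_filter, mem_powerset, mem_powersetCard]
      grind
    rw [h, sum_congr rfl (g := fun _ => X ^ j) fun T hT => by rw [(mem_powersetCard.1 hT).2],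
      sum_const, card_powersetCard, nsmul_eq_mul]
    simp
  have part (p : ι → Finset α) (hp : ∀ r, ∀ w ∈ p r, c w = r) (r : ι) :
      (univ.biUnion p).filter (fun w => c w = r) = p r := by
    ext w
    simp only [mem_filter, mem_biUnion, mem_univ, true_and]
    grind
  simp only [fiber, prod_univ_sum, prod_pow_eq_pow_sum]
  refine sum_nbij' (fun p => univ.biUnion p) (fun G r => G.filter fun w => c w = r) ?_ ?_ ?_ ?_ ?_
  · intro p hp
    simp only [Fintype.mem_piFinset, mem_filter, mem_powerset, subset_iff, mem_univ,
      true_and] at hp ⊢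
    intro r
    rw [part p (fun r => (hp r).1)]
    exact (hp r).2
  · intro G hG
    simp only [Fintype.mem_piFinset, mem_filter, mem_powerset, subset_iff, mem_univ,
      true_and] at hG ⊢
    exact fun r => ⟨fun w hw => hw.2, hG r⟩
  · intro p hp
    simp only [Fintype.mem_piFinset, mem_filter, mem_powerset, subset_iff, mem_univ,
      true_and] at hp
    exact funext (part p fun r => (hp r).1)
  · intro G _
    ext w
    simp
  · intro p hp
    simp only [Fintype.mem_piFinset, mem_filter, mem_powerset, subset_iff, mem_univ,
      true_and] at hp
    rw [card_eq_sum_card_fiberwise (f := c) (t := univ) (s := univ.biUnion p) (by simp)]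
    simp only [part p fun r => (hp r).1]

/-- The number of `n`-element finsets in which colour `ℓ` is the strict mode with count `i`. -/
theorem card_strict_mode_eq {α ι : Type*} [Fintype α] [Fintype ι] [DecidableEq ι]
    (c : α → ι) (ℓ : ι)
    {n i : ℕ} (hi : i ≤ n) :
    (((univ : Finset α).powersetCard n).filter fun G =>
        (G.filter fun w => c w = ℓ).card = i ∧
          ∀ r, r ≠ ℓ → (G.filter fun w => c w = r).card < i).card =
      (univ.filter fun w => c w = ℓ).card.choose i *
        (∏ r ∈ univ.erase ℓ, ∑ j ∈ range i,
          (Polynomial.C ((univ.filter fun w => c w = r).card.choose j) * X ^ j : ℕ[X])).coeff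
            (n - i) := by
  have h := congrArg (fun P : ℕ[X] => P.coeff n)
    (prod_sum_choose_mul_X_pow c fun r => if r = ℓ then {i} else range i)
  beta_reduce at h
  rw [← mul_prod_erase _ _ (mem_univ ℓ), if_pos rfl, sum_singleton, mul_assoc,
    Polynomial.coeff_C_mul, Polynomial.coeff_X_pow_mul', if_pos hi,
    prod_congr rfl fun r hr => by rw [if_neg (ne_of_mem_erase hr)]] at h
  rw [h, Polynomial.finsetSum_coeff]
  simp only [Polynomial.coeff_X_pow]
  rw [← card_filter]
  congr 1
  ext G
  simp only [mem_filter, mem_powersetCard_univ, mem_univ, true_and]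
  constructor
  · rintro ⟨hG, hℓ, hr⟩
    refine ⟨fun r => ?_, hG.symm⟩
    split_ifs with hrℓ
    · simpa [hrℓ] using hℓ
    · simpa using hr r hrℓ
  · rintro ⟨hG, hn⟩
    refine ⟨hn.symm, by simpa using hG ℓ, fun r hr => ?_⟩
    simpa [hr] using hG r

/-- Workers are the elements of `Fin N`, partitioned into categories via
`cat : Fin N → Fin (k+1)`.  For an `n`-element subset `G` chosen uniformly at random, the
events `E_ℓ = {G : category ℓ is the strict mode of G with count ≥ i₀}` are pairwise
disjoint, and hence the probability `q` that some category is a strict mode with count at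
least `i₀` equals `∑_ℓ q̂_ℓ = ∑_{i=i₀}^{n} ∑_{ℓ=0}^{k} C(N_ℓ, i) a_{i,ℓ} / C(N, n)`,
where `a_{i,ℓ}` is the coefficient of `x^(n-i)` in `∏_{r ≠ ℓ} ∑_{j=0}^{i-1} C(N_r, j) x^j`. -/
theorem mode_events_disjoint_and_prob_sum
    (N k n i₀ : ℕ) (hn : 1 ≤ n) (hnN : n ≤ N) (hi₀1 : 1 ≤ i₀) (hi₀n : i₀ ≤ n)
    (cat : Fin N → Fin (k + 1)) :
    (∀ ℓ ℓ' : Fin (k + 1), ℓ ≠ ℓ' →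
      Disjoint
        (((Finset.univ : Finset (Fin N)).powersetCard n).filter fun G =>
          ∃ i, i₀ ≤ i ∧ (G.filter fun w => cat w = ℓ).card = i ∧
            ∀ r : Fin (k + 1), r ≠ ℓ → (G.filter fun w => cat w = r).card < i)
        (((Finset.univ : Finset (Fin N)).powersetCard n).filter fun G =>
          ∃ i, i₀ ≤ i ∧ (G.filter fun w => cat w = ℓ').card = i ∧
            ∀ r : Fin (k + 1), r ≠ ℓ' → (G.filter fun w => cat w = r).card < i))
    ∧
    ((((Finset.univ : Finset (Fin N)).powersetCard n).filter fun G =>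
        ∃ ℓ : Fin (k + 1), ∃ i, i₀ ≤ i ∧ (G.filter fun w => cat w = ℓ).card = i ∧
          ∀ r : Fin (k + 1), r ≠ ℓ → (G.filter fun w => cat w = r).card < i).card : ℚ)
      / (N.choose n)
      =
    (∑ i ∈ Finset.Icc i₀ n, ∑ ℓ : Fin (k + 1),
        (((Finset.univ.filter fun w => cat w = ℓ)).card.choose i *
          (∏ r ∈ Finset.univ.erase ℓ,
              ∑ j ∈ Finset.range i,
                (Polynomial.C (((Finset.univ.filter fun w => cat w = r)).card.choose j)
                  * X ^ j : Polynomial ℕ)).coeff (n - i) : ℚ))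
      / (N.choose n) := by
  refine ⟨fun ℓ ℓ' hne => disjoint_left.2 fun G hG hG' => ?_, ?_⟩
  · obtain ⟨-, i, -, hi, hlt⟩ := mem_filter.1 hG
    obtain ⟨-, j, -, hj, hlt'⟩ := mem_filter.1 hG'
    have h₁ := hlt ℓ' hne.symm
    have h₂ := hlt' ℓ hne
    omega
  · congr 1
    rw [← sum_product', sum_congr rfl fun p hp => by
      rw [← Nat.cast_mul, ← card_strict_mode_eq cat p.2
        (mem_Icc.1 (mem_product.1 hp).1).2], ← Nat.cast_sum, ← card_biUnion]
    · congr 2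
      ext G
      simp only [mem_filter, mem_biUnion, mem_product, mem_Icc, mem_univ, and_true,
        mem_powersetCard_univ, Prod.exists]
      constructor
      · rintro ⟨hG, ℓ, i, hi, hℓ, hr⟩
        exact ⟨i, ℓ, ⟨hi, hℓ ▸ hG ▸ card_filter_le _ _⟩, hG, hℓ, hr⟩
      · rintro ⟨i, ℓ, hi, hG, hℓ, hr⟩
        exact ⟨hG, ℓ, i, hi.1, hℓ, hr⟩
    · rintro ⟨i, ℓ⟩ - ⟨j, ℓ'⟩ - hne
      refine disjoint_left.2 fun G hG hG' => ?_
      simp only [mem_filter] at hG hG'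
      obtain ⟨-, hi, hlt⟩ := hG
      obtain ⟨-, hj, hlt'⟩ := hG'
      rcases eq_or_ne ℓ ℓ' with rfl | h
      · exact hne (by simp_all)
      · have h₁ := hlt ℓ' h.symm
        have h₂ := hlt' ℓ h
        omega
end

section
/- Let a finite set of N workers be partitioned into categories C_0, C_1, ..., C_k with |C_r| = N_r, let 1 ≤ n ≤ N, let i_0 be an integer with 1 ≤ i_0 ≤ n, fix a worker w in category C_ℓ. Then the number of n-element subsets G containing w such that category ℓ is the strict mode of G with count at least i_0 equals ∑_{i=i_0−1}^{n−1} C(N_ℓ−1, i) · b_{i,ℓ}, where b_{i,ℓ} is the coefficient of x^{n−1−i} in ∏_{r=0, r≠ℓ}^{k} ( ∑_{j=0}^{i} C(N_r, j) x^j ). Consequently, conditional on w being a member of a uniformly random n-element subset G, the probability that category ℓ is the strict mode of G with count at least i_0 equals ( ∑_{i=i_0−1}^{n−1} C(N_ℓ−1, i) b_{i,ℓ} ) / C(N−1, n−1). -/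
open Finset Polynomial
open scoped Classical

/-- The coefficient of `X ^ m` in a product of truncated binomial generating functions counts the
`m`-subsets of the fibres over `R` that meet each of these fibres in at most `i` elements. -/
theorem coeff_prod_sum_choose_eq_card {α ι : Type*} [Fintype α] [DecidableEq α] [DecidableEq ι]
    (c : α → ι) (i : ℕ) (R : Finset ι) (m : ℕ) :
    (∏ r ∈ R, ∑ j ∈ range (i + 1),
      (Polynomial.C ((univ.filter fun v => c v = r).card.choose j) * X ^ j :
        Polynomial ℕ)).coeff m =
      (((univ.filter fun v => c v ∈ R).powersetCard m).filter fun H =>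
        ∀ r ∈ R, (H.filter fun v => c v = r).card ≤ i).card := by
  induction R using Finset.induction_on generalizing m with
  | empty =>
    rw [prod_empty, coeff_one]
    rcases m with _ | m <;> simp
  | insert a R ha ih =>
    rw [prod_insert ha, coeff_mul, card_eq_sum_card_fiberwise
      (f := fun H : Finset α =>
        ((H.filter fun v => c v = a).card, (H.filter fun v => ¬ c v = a).card))
      (t := antidiagonal m)]
    · refine sum_congr rfl fun p hp => ?_
      have hp' : p.1 + p.2 = m := mem_antidiagonal.1 hp
      have hcoeff : (∑ j ∈ range (i + 1),
          (Polynomial.C ((univ.filter fun v => c v = a).card.choose j) * X ^ j :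
            Polynomial ℕ)).coeff p.1 =
          (((univ.filter fun v => c v = a).powersetCard p.1).filter fun H => H.card ≤ i).card := by
        simp only [finsetSum_coeff, coeff_C_mul, coeff_X_pow, mul_ite, mul_one, mul_zero,
          sum_ite_eq, mem_range]
        split_ifs with h
        · rw [← card_powersetCard]
          refine congrArg card (filter_true_of_mem fun H hH => ?_).symm
          have := (mem_powersetCard.1 hH).2
          omega
        · rw [filter_false_of_mem, card_empty]
          intro H hH
          have := (mem_powersetCard.1 hH).2
          omega
      rw [hcoeff, ih, ← card_product]
      refine card_nbij' (fun q => q.1 ∪ q.2)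
        (fun H => (H.filter fun v => c v = a, H.filter fun v => ¬ c v = a)) ?_ ?_ ?_ ?_
      · rintro ⟨A, B⟩ h
        simp only [coe_product, Set.mem_prod, mem_coe, mem_filter, mem_powersetCard,
          subset_iff, mem_univ, true_and] at h
        obtain ⟨⟨⟨hA, hAc⟩, hAi⟩, ⟨hB, hBc⟩, hBi⟩ := h
        have h1 : (A ∪ B).filter (fun v => c v = a) = A := by
          ext v; simp only [mem_filter, mem_union]; grind
        have h2 : (A ∪ B).filter (fun v => ¬ c v = a) = B := by
          ext v; simp only [mem_filter, mem_union]; grind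
        have h3 : ∀ r ∈ R, (A ∪ B).filter (fun v => c v = r) = B.filter fun v => c v = r := by
          intro r hr
          ext v; simp only [mem_filter, mem_union]; grind
        simp only [mem_coe, mem_filter, mem_powersetCard, subset_iff, mem_univ, true_and, h1, h2]
        refine ⟨⟨⟨?_, ?_⟩, ?_⟩, by rw [hAc, hBc]⟩
        · intro v hv
          simp only [mem_union] at hv
          grind
        · rw [card_union_of_disjoint, hAc, hBc, hp']
          rw [Finset.disjoint_left]
          grind
        · intro r hr
          rcases mem_insert.1 hr with rfl | hr
          · rwa [h1]
          · rw [h3 r hr]; exact hBi r hr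
      · intro H h
        simp only [mem_coe, mem_filter, mem_powersetCard, subset_iff, mem_univ, true_and,
          mem_insert] at h
        obtain ⟨⟨⟨hH, hHc⟩, hHi⟩, rfl⟩ := h
        simp only [coe_product, Set.mem_prod, mem_coe, mem_filter, mem_powersetCard,
          subset_iff, mem_univ, true_and]
        refine ⟨⟨⟨fun _ h => h.2, trivial⟩, hHi a (Or.inl rfl)⟩, ⟨fun v hv => ?_, trivial⟩, fun r hr => ?_⟩
        · exact (hH hv.1).resolve_left hv.2
        · exact (card_le_card (filter_subset_filter _ (filter_subset _ _))).trans
            (hHi r (Or.inr hr))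
      · rintro ⟨A, B⟩ h
        simp only [coe_product, Set.mem_prod, mem_coe, mem_filter, mem_powersetCard,
          subset_iff, mem_univ, true_and] at h
        ext v <;> simp only [mem_filter, mem_union] <;> grind
      · intro H _
        exact filter_union_filter_not_eq _ _
    · intro H h
      simp only [mem_coe, mem_filter, mem_powersetCard] at h
      rw [mem_coe, HasAntidiagonal.mem_antidiagonal, card_filter_add_card_filter_not, h.1.2]

/-- The `n`-subsets containing `w` that meet the fibre of `w` in `i + 1` elements and every other
fibre in at most `i` elements. -/
theorem card_filter_strictMode_eq {α ι : Type*} [Fintype α] [DecidableEq α] [Fintype ι]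
    [DecidableEq ι] (c : α → ι) (w : α) (n i : ℕ) (hi : i + 1 ≤ n) :
    (((univ : Finset α).powersetCard n).filter fun G =>
      w ∈ G ∧ (G.filter fun v => c v = c w).card = i + 1 ∧
        ∀ r, r ≠ c w → (G.filter fun v => c v = r).card ≤ i).card =
      ((univ.filter fun v => c v = c w).card - 1).choose i *
        (((univ.filter fun v => c v ∈ univ.erase (c w)).powersetCard (n - 1 - i)).filter fun H =>
          ∀ r ∈ univ.erase (c w), (H.filter fun v => c v = r).card ≤ i).card := by
  have hwmem : w ∈ univ.filter fun v => c v = c w := by simp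
  rw [← card_erase_of_mem hwmem, ← card_powersetCard, ← card_product]
  symm
  refine card_nbij' (fun q => insert w (q.1 ∪ q.2))
    (fun G => ((G.filter fun v => c v = c w).erase w, G.filter fun v => ¬ c v = c w)) ?_ ?_ ?_ ?_
  · rintro ⟨A, B⟩ h
    simp only [coe_product, Set.mem_prod, mem_coe, mem_filter, mem_powersetCard,
      subset_iff, mem_univ, true_and, mem_erase, and_true] at h
    obtain ⟨⟨hA, hAc⟩, ⟨hB, hBc⟩, hBi⟩ := h
    have hwA : w ∉ A := fun h => (hA h).1 rfl
    have h1 : (insert w (A ∪ B)).filter (fun v => c v = c w) = insert w A := by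
      ext v; simp only [mem_filter, mem_union, mem_insert]; grind
    have h2 : (insert w (A ∪ B)).filter (fun v => ¬ c v = c w) = B := by
      ext v; simp only [mem_filter, mem_union, mem_insert]; grind
    have h3 : ∀ r, r ≠ c w →
        (insert w (A ∪ B)).filter (fun v => c v = r) = B.filter fun v => c v = r := by
      intro r hr
      ext v; simp only [mem_filter, mem_union, mem_insert]; grind
    simp only [mem_coe, mem_filter, mem_powersetCard, subset_univ, true_and, h1,
      card_insert_of_notMem hwA, hAc, mem_insert_self]
    refine ⟨?_, fun r hr => ?_⟩
    · rw [← card_filter_add_card_filter_not (fun v => c v = c w), h1, h2,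
        card_insert_of_notMem hwA]
      omega
    · rw [h3 r hr]; exact hBi r hr
  · intro G h
    simp only [mem_coe, mem_filter, mem_powersetCard, subset_univ, true_and] at h
    obtain ⟨hGc, hwG, hGi, hGr⟩ := h
    simp only [coe_product, Set.mem_prod, mem_coe, mem_filter, mem_powersetCard,
      subset_iff, mem_univ, true_and, mem_erase, and_true]
    have hs := card_filter_add_card_filter_not (s := G) (fun v => c v = c w)
    refine ⟨⟨fun _ h => ⟨h.1, h.2.2⟩, ?_⟩, ⟨fun _ h => h.2, by omega⟩, fun r hr => ?_⟩
    · rw [card_erase_of_mem (by simp [hwG]), hGi, Nat.add_sub_cancel]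
    · exact (card_le_card (filter_subset_filter _ (filter_subset _ _))).trans (hGr r hr)
  · rintro ⟨A, B⟩ h
    simp only [coe_product, Set.mem_prod, mem_coe, mem_filter, mem_powersetCard,
      subset_iff, mem_univ, true_and, mem_erase, and_true] at h
    ext v <;> simp only [mem_filter, mem_union, mem_insert, mem_erase] <;> grind
  · intro G h
    simp only [mem_coe, mem_filter] at h
    ext v
    simp only [mem_filter, mem_union, mem_insert, mem_erase]
    grind

/-- Workers are the elements of `Fin N`, partitioned into categories via
`cat : Fin N → Fin (k+1)`, and `w` is a fixed worker in category `ℓ`.  The number of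
`n`-element subsets `G` containing `w` such that category `ℓ` is the strict mode of `G`
with count at least `i₀` equals `∑_{i=i₀-1}^{n-1} C(N_ℓ - 1, i) · b_{i,ℓ}`, where
`b_{i,ℓ}` is the coefficient of `x^(n-1-i)` in `∏_{r ≠ ℓ} (∑_{j=0}^{i} C(N_r, j) x^j)`.
Consequently, conditional on `w` belonging to a uniformly random `n`-element subset `G`
(there are `C(N-1, n-1)` such subsets), the probability that category `ℓ` is the strict
mode of `G` with count at least `i₀` equals
`(∑_{i=i₀-1}^{n-1} C(N_ℓ - 1, i) b_{i,ℓ}) / C(N-1, n-1)`. -/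
theorem card_and_condProb_mode_given_worker
    (N k n i₀ : ℕ) (hn : 1 ≤ n) (hnN : n ≤ N) (hi₀1 : 1 ≤ i₀) (hi₀n : i₀ ≤ n)
    (cat : Fin N → Fin (k + 1)) (ℓ : Fin (k + 1)) (w : Fin N) (hw : cat w = ℓ) :
    ((((Finset.univ : Finset (Fin N)).powersetCard n).filter fun G =>
        w ∈ G ∧ ∃ i, i₀ ≤ i ∧ (G.filter fun v => cat v = ℓ).card = i ∧
          ∀ r : Fin (k + 1), r ≠ ℓ → (G.filter fun v => cat v = r).card < i).card
      =
      ∑ i ∈ Finset.Icc (i₀ - 1) (n - 1),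
        (((Finset.univ.filter fun v => cat v = ℓ)).card - 1).choose i *
          (∏ r ∈ Finset.univ.erase ℓ,
              ∑ j ∈ Finset.range (i + 1),
                (Polynomial.C (((Finset.univ.filter fun v => cat v = r)).card.choose j)
                  * X ^ j : Polynomial ℕ)).coeff (n - 1 - i))
    ∧
    (((((Finset.univ : Finset (Fin N)).powersetCard n).filter fun G =>
        w ∈ G ∧ ∃ i, i₀ ≤ i ∧ (G.filter fun v => cat v = ℓ).card = i ∧
          ∀ r : Fin (k + 1), r ≠ ℓ → (G.filter fun v => cat v = r).card < i).card : ℚ)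
      / ((N - 1).choose (n - 1))
      =
      (∑ i ∈ Finset.Icc (i₀ - 1) (n - 1),
        ((((Finset.univ.filter fun v => cat v = ℓ)).card - 1).choose i *
          (∏ r ∈ Finset.univ.erase ℓ,
              ∑ j ∈ Finset.range (i + 1),
                (Polynomial.C (((Finset.univ.filter fun v => cat v = r)).card.choose j)
                  * X ^ j : Polynomial ℕ)).coeff (n - 1 - i) : ℚ))
      / ((N - 1).choose (n - 1))) := by
  subst hw
  refine and_iff_left_of_imp (fun key => ?_) |>.2 ?_
  · rw [key]
    push_cast
    rfl
  rw [card_eq_sum_card_fiberwise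
    (f := fun G : Finset (Fin N) => (G.filter fun v => cat v = cat w).card - 1)
    (t := Icc (i₀ - 1) (n - 1))]
  · refine sum_congr rfl fun i hi => ?_
    rw [mem_Icc] at hi
    rw [coeff_prod_sum_choose_eq_card, filter_filter]
    refine Eq.trans (congrArg card ?_)
      ((card_filter_strictMode_eq cat w n i (by omega)).trans (by congr!))
    ext G
    simp only [mem_filter]
    refine and_congr_right fun _ => ?_
    constructor
    · rintro ⟨⟨hwG, j, hj, rfl, hr⟩, h⟩
      have hi' : (G.filter fun v => cat v = cat w).card = i + 1 := by omega
      exact ⟨hwG, hi', fun r h => by have := hr r h; omega⟩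
    · rintro ⟨hwG, h, hr⟩
      exact ⟨⟨hwG, i + 1, by omega, h, fun r h => Nat.lt_succ_of_le (hr r h)⟩, by omega⟩
  · intro G hG
    simp only [mem_coe, mem_filter, mem_powersetCard] at hG
    obtain ⟨⟨-, hGc⟩, -, j, hj, rfl, -⟩ := hG
    have := card_filter_le G fun v => cat v = cat w
    simp only [mem_coe, mem_Icc]
    omega
end

section
/- Let A ∈ ℝ^{m×d} be a matrix whose rows A_1, ..., A_m are all nonzero, let b ∈ ℝ^m and x* ∈ ℝ^d satisfy A x* = b, and let x ∈ ℝ^d. For a row index j, let P_j(x) = x + ((b_j − ⟨A_j, x⟩)/‖A_j‖²) A_jᵀ denote the Kaczmarz projection of x onto the hyperplane {z : ⟨A_j, z⟩ = b_j}. Then for any scalar e ∈ ℝ, the perturbed update satisfies the exact Pythagorean identity ‖x + ((b_j − ⟨A_j, x⟩ + e)/‖A_j‖²) A_jᵀ − x*‖² = ‖P_j(x) − x*‖² + e²/‖A_j‖². -/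
open Finset
open scoped RealInnerProductSpace

/-- `A` has rows `A j ∈ ℝ^d` (all nonzero), `A x* = b`
(i.e. `⟪A j, x*⟫ = b j` for all `j`), and `P_j(x) = x + ((b_j - ⟪A_j, x⟫)/‖A_j‖²) A_jᵀ`
is the Kaczmarz projection.  For any scalar `e`, the perturbed update satisfies the exact
Pythagorean identity
`‖x + ((b_j - ⟪A_j,x⟫ + e)/‖A_j‖²) A_jᵀ - x*‖² = ‖P_j(x) - x*‖² + e²/‖A_j‖²`. -/
theorem perturbed_kaczmarz_pythagorean
    (m d : ℕ) (A : Fin m → EuclideanSpace ℝ (Fin d)) (b : Fin m → ℝ)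
    (xstar x : EuclideanSpace ℝ (Fin d))
    (hA : ∀ j, A j ≠ 0) (hsol : ∀ j, ⟪A j, xstar⟫ = b j)
    (j : Fin m) (e : ℝ) :
    ‖x + ((b j - ⟪A j, x⟫ + e) / ‖A j‖ ^ 2) • A j - xstar‖ ^ 2
      = ‖x + ((b j - ⟪A j, x⟫) / ‖A j‖ ^ 2) • A j - xstar‖ ^ 2 + e ^ 2 / ‖A j‖ ^ 2 := by
  have hnorm : ‖A j‖ ≠ 0 := norm_ne_zero_iff.mpr (hA j)
  have horth : ⟪x + ((b j - ⟪A j, x⟫) / ‖A j‖ ^ 2) • A j - xstar, A j⟫ = 0 := by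
    rw [real_inner_comm, inner_sub_right, inner_add_right, real_inner_smul_right,
      real_inner_self_eq_norm_sq, hsol j]
    field_simp
    ring
  have hsplit : x + ((b j - ⟪A j, x⟫ + e) / ‖A j‖ ^ 2) • A j - xstar
      = (x + ((b j - ⟪A j, x⟫) / ‖A j‖ ^ 2) • A j - xstar) + (e / ‖A j‖ ^ 2) • A j := by
    rw [add_div, add_smul]
    abel
  rw [hsplit, norm_add_sq_real, real_inner_smul_right, horth, norm_smul, mul_pow,
    Real.norm_eq_abs, sq_abs]
  field_simp
  ring
end

section
/- Let A ∈ ℝ^{m×d} be a matrix whose rows A_1, ..., A_m are all nonzero, let b ∈ ℝ^m and x* ∈ ℝ^d satisfy A x* = b, and let x ∈ ℝ^d. With P_j(x) = x + ((b_j − ⟨A_j, x⟩)/‖A_j‖²) A_jᵀ, the expected squared error of one randomized Kaczmarz step with row j selected with probability ‖A_j‖²/‖A‖_F² satisfies the exact identity ∑_{j=1}^{m} (‖A_j‖²/‖A‖_F²) ‖P_j(x) − x*‖² = ‖x − x*‖² − ‖A(x − x*)‖²/‖A‖_F². -/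
open Finset
open scoped RealInnerProductSpace

/-- The squared distance from `y` to the line spanned by `a`,
scaled by `‖a‖ ^ 2`. -/
theorem norm_sq_mul_norm_sub_inner_div_smul_sq {E : Type*} [NormedAddCommGroup E]
    [InnerProductSpace ℝ E] (a y : E) :
    ‖a‖ ^ 2 * ‖y - (⟪a, y⟫ / ‖a‖ ^ 2) • a‖ ^ 2 = ‖a‖ ^ 2 * ‖y‖ ^ 2 - ⟪a, y⟫ ^ 2 := by
  rcases eq_or_ne a 0 with rfl | ha
  · simp
  have ha' : ‖a‖ ≠ 0 := norm_ne_zero_iff.mpr ha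
  rw [norm_sub_sq_real, real_inner_smul_right, norm_smul, mul_pow, Real.norm_eq_abs, sq_abs,
    real_inner_comm]
  field_simp
  ring

/-- `A` has rows `A j ∈ ℝ^d` (all nonzero, `m ≥ 1`), `A x* = b`, and
`P_j(x) = x + ((b_j - ⟪A_j, x⟫)/‖A_j‖²) A_jᵀ`.  The expected squared error of one
randomized Kaczmarz step, with row `j` selected with probability `‖A_j‖²/‖A‖_F²`
(where `‖A‖_F² = ∑_j ‖A_j‖²`), satisfies the exact identity
`∑_j (‖A_j‖²/‖A‖_F²) ‖P_j(x) - x*‖² = ‖x - x*‖² - ‖A(x - x*)‖²/‖A‖_F²`,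
with `‖A v‖² = ∑_j ⟪A_j, v⟫²`. -/
theorem randomized_kaczmarz_expected_step
    (m d : ℕ) (hm : 0 < m) (A : Fin m → EuclideanSpace ℝ (Fin d)) (b : Fin m → ℝ)
    (xstar x : EuclideanSpace ℝ (Fin d))
    (hA : ∀ j, A j ≠ 0) (hsol : ∀ j, ⟪A j, xstar⟫ = b j) :
    ∑ j, (‖A j‖ ^ 2 / ∑ j', ‖A j'‖ ^ 2) *
        ‖x + ((b j - ⟪A j, x⟫) / ‖A j‖ ^ 2) • A j - xstar‖ ^ 2
      = ‖x - xstar‖ ^ 2 - (∑ j, ⟪A j, x - xstar⟫ ^ 2) / ∑ j', ‖A j'‖ ^ 2 := by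
  have hS : ∑ j, ‖A j‖ ^ 2 ≠ 0 :=
    (Finset.sum_pos (fun j _ => pow_pos (norm_pos_iff.mpr (hA j)) 2)
      ⟨⟨0, hm⟩, Finset.mem_univ _⟩).ne'
  have hstep (j : Fin m) : x + ((b j - ⟪A j, x⟫) / ‖A j‖ ^ 2) • A j - xstar =
      (x - xstar) - (⟪A j, x - xstar⟫ / ‖A j‖ ^ 2) • A j := by
    rw [← hsol j, inner_sub_right]
    module
  simp_rw [hstep, div_mul_eq_mul_div, norm_sq_mul_norm_sub_inner_div_smul_sq]
  rw [← Finset.sum_div, Finset.sum_sub_distrib, ← Finset.sum_mul, sub_div,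
    mul_div_cancel_left₀ _ hS]
end

section
/- Let A ∈ ℝ^{m×d} with m ≥ d, all rows A_j nonzero, and smallest singular value σ_min(A) (so that ‖A v‖ ≥ σ_min(A) ‖v‖ for all v ∈ ℝ^d). Let b ∈ ℝ^m and x* ∈ ℝ^d satisfy A x* = b. Then for every x ∈ ℝ^d, ∑_{j=1}^{m} (‖A_j‖²/‖A‖_F²) ‖P_j(x) − x*‖² ≤ (1 − σ_min(A)²/‖A‖_F²) ‖x − x*‖², where P_j(x) = x + ((b_j − ⟨A_j, x⟩)/‖A_j‖²) A_jᵀ. -/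
open Finset
open scoped RealInnerProductSpace

/-- Pythagoras for the orthogonal projection of `x` onto the hyperplane through `y` with normal
vector `a`. -/
theorem norm_sq_hyperplane_projection_sub {E : Type*} [NormedAddCommGroup E]
    [InnerProductSpace ℝ E] {a : E} (ha : a ≠ 0) (x y : E) :
    ‖x + ((⟪a, y⟫ - ⟪a, x⟫) / ‖a‖ ^ 2) • a - y‖ ^ 2
      = ‖x - y‖ ^ 2 - ⟪a, x - y⟫ ^ 2 / ‖a‖ ^ 2 := by
  have hn : ‖a‖ ≠ 0 := norm_ne_zero_iff.mpr ha
  rw [add_sub_right_comm, ← neg_sub ⟪a, x⟫, ← inner_sub_right, norm_add_sq_real,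
    real_inner_smul_right, real_inner_comm, norm_smul, mul_pow, Real.norm_eq_abs, sq_abs]
  field_simp
  ring

/-- `A` has rows `A j ∈ ℝ^d` (all nonzero), `m ≥ d`, and smallest singular
value `σ ≥ 0`, so that `‖A v‖ ≥ σ ‖v‖` for all `v`, encoded as
`σ² ‖v‖² ≤ ∑_j ⟪A_j, v⟫² = ‖A v‖²`.  With `A x* = b`, for every `x`,
`∑_j (‖A_j‖²/‖A‖_F²) ‖P_j(x) - x*‖² ≤ (1 - σ²/‖A‖_F²) ‖x - x*‖²`,
where `P_j(x) = x + ((b_j - ⟪A_j, x⟫)/‖A_j‖²) A_jᵀ` and `‖A‖_F² = ∑_j ‖A_j‖²`. -/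
theorem randomized_kaczmarz_contraction
    (m d : ℕ) (hm : 0 < m) (hd : d ≤ m)
    (A : Fin m → EuclideanSpace ℝ (Fin d)) (b : Fin m → ℝ)
    (xstar x : EuclideanSpace ℝ (Fin d)) (σ : ℝ)
    (hA : ∀ j, A j ≠ 0) (hσ0 : 0 ≤ σ)
    (hσ : ∀ v : EuclideanSpace ℝ (Fin d), σ ^ 2 * ‖v‖ ^ 2 ≤ ∑ j, ⟪A j, v⟫ ^ 2)
    (hsol : ∀ j, ⟪A j, xstar⟫ = b j) :
    ∑ j, (‖A j‖ ^ 2 / ∑ j', ‖A j'‖ ^ 2) *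
        ‖x + ((b j - ⟪A j, x⟫) / ‖A j‖ ^ 2) • A j - xstar‖ ^ 2
      ≤ (1 - σ ^ 2 / ∑ j', ‖A j'‖ ^ 2) * ‖x - xstar‖ ^ 2 := by
  have hpos : 0 < ∑ j, ‖A j‖ ^ 2 :=
    Finset.sum_pos (fun j _ => pow_pos (norm_pos_iff.mpr (hA j)) 2) ⟨⟨0, hm⟩, Finset.mem_univ _⟩
  set F := ∑ j, ‖A j‖ ^ 2
  have hterm : ∀ j, (‖A j‖ ^ 2 / F) * ‖x + ((b j - ⟪A j, x⟫) / ‖A j‖ ^ 2) • A j - xstar‖ ^ 2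
      = (‖A j‖ ^ 2 * ‖x - xstar‖ ^ 2 - ⟪A j, x - xstar⟫ ^ 2) / F := fun j => by
    have hn : ‖A j‖ ≠ 0 := norm_ne_zero_iff.mpr (hA j)
    rw [← hsol j, norm_sq_hyperplane_projection_sub (hA j)]
    field_simp
  calc _ = (F * ‖x - xstar‖ ^ 2 - ∑ j, ⟪A j, x - xstar⟫ ^ 2) / F := by
        rw [Finset.sum_congr rfl fun j _ => hterm j, ← Finset.sum_div, Finset.sum_sub_distrib,
          ← Finset.sum_mul]
    _ ≤ (F * ‖x - xstar‖ ^ 2 - σ ^ 2 * ‖x - xstar‖ ^ 2) / F := by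
        gcongr
        exact hσ _
    _ = _ := by field_simp
end

section
/- Let A ∈ ℝ^{m×d} with m ≥ d, all rows A_j nonzero, smallest singular value σ_min(A), and set α = 1 − σ_min(A)²/‖A‖_F². Let b ∈ ℝ^m and x* ∈ ℝ^d satisfy A x* = b. Let q_0, q_1, ..., q_k ≥ 0 with ∑_{ℓ=0}^{k} q_ℓ = 1, and let e_0 = 0, e_1, ..., e_k ∈ ℝ^m be error vectors. Then for every x ∈ ℝ^d, the one-step expected squared error of the adversarial randomized Kaczmarz update — where independently a row j is selected with probability ‖A_j‖²/‖A‖_F² and an error category ℓ with probability q_ℓ, and x is updated to x + ((b_j − ⟨A_j, x⟩ + e_ℓ(j))/‖A_j‖²) A_jᵀ — satisfies ∑_{ℓ=0}^{k} q_ℓ ∑_{j=1}^{m} (‖A_j‖²/‖A‖_F²) ‖x + ((b_j − ⟨A_j, x⟩ + e_ℓ(j))/‖A_j‖²) A_jᵀ − x*‖² ≤ α ‖x − x*‖² + (1/‖A‖_F²) ∑_{ℓ=1}^{k} q_ℓ ‖e_ℓ‖². -/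
open Finset
open scoped RealInnerProductSpace

/-- Squared error of one Kaczmarz step along a nonzero row `a`, with error `ε` in the residual. -/
lemma norm_sq_add_kaczmarz_step {E : Type*} [NormedAddCommGroup E] [InnerProductSpace ℝ E]
    {a : E} (ha : a ≠ 0) (v : E) (ε : ℝ) :
    ‖a‖ ^ 2 * ‖v + ((ε - ⟪a, v⟫) / ‖a‖ ^ 2) • a‖ ^ 2
      = ‖a‖ ^ 2 * ‖v‖ ^ 2 + (ε ^ 2 - ⟪a, v⟫ ^ 2) := by
  have hn : ‖a‖ ≠ 0 := norm_ne_zero_iff.mpr ha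
  rw [norm_add_sq_real, inner_smul_right, norm_smul, mul_pow, Real.norm_eq_abs, sq_abs,
    real_inner_comm]
  field_simp
  ring

/-- Expected squared error of one Kaczmarz step for a fixed residual error vector `ε`, when the
rows are sampled with probability proportional to their squared norms. -/
lemma sum_norm_sq_add_kaczmarz_step {ι E : Type*} [Fintype ι] [NormedAddCommGroup E]
    [InnerProductSpace ℝ E] {A : ι → E} (hA : ∀ j, A j ≠ 0) (hF : ∑ j, ‖A j‖ ^ 2 ≠ 0)
    (v : E) (ε : ι → ℝ) :
    ∑ j, (‖A j‖ ^ 2 / ∑ j', ‖A j'‖ ^ 2) * ‖v + ((ε j - ⟪A j, v⟫) / ‖A j‖ ^ 2) • A j‖ ^ 2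
      = ‖v‖ ^ 2 + (∑ j, ε j ^ 2 - ∑ j, ⟪A j, v⟫ ^ 2) / ∑ j, ‖A j‖ ^ 2 := by
  simp_rw [div_mul_eq_mul_div, norm_sq_add_kaczmarz_step (hA _)]
  rw [← Finset.sum_div, Finset.sum_add_distrib, Finset.sum_sub_distrib, ← Finset.sum_mul]
  field_simp

/-- `A` has rows `A j ∈ ℝ^d` (all nonzero), `m ≥ d`, smallest singular
value `σ` (so `σ² ‖v‖² ≤ ∑_j ⟪A_j, v⟫² = ‖A v‖²` for all `v`), `α = 1 - σ²/‖A‖_F²`,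
and `A x* = b`.  Category probabilities `q_0, …, q_k ≥ 0` sum to `1`, error vectors
`e_0 = 0, e_1, …, e_k ∈ ℝ^m`.  The one-step expected squared error of the adversarial
randomized Kaczmarz update — row `j` with probability `‖A_j‖²/‖A‖_F²`, independently
category `ℓ` with probability `q_ℓ`, updating `x` to
`x + ((b_j - ⟪A_j,x⟫ + e_ℓ(j))/‖A_j‖²) A_jᵀ` — satisfies
`∑_ℓ q_ℓ ∑_j (‖A_j‖²/‖A‖_F²) ‖update - x*‖² ≤ α ‖x - x*‖² + (1/‖A‖_F²) ∑_{ℓ=1}^k q_ℓ ‖e_ℓ‖²`. -/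
theorem adversarial_kaczmarz_one_step
    (m d k : ℕ) (hm : 0 < m) (hd : d ≤ m)
    (A : Fin m → EuclideanSpace ℝ (Fin d)) (b : Fin m → ℝ)
    (xstar x : EuclideanSpace ℝ (Fin d)) (σ : ℝ)
    (hA : ∀ j, A j ≠ 0) (hσ0 : 0 ≤ σ)
    (hσ : ∀ v : EuclideanSpace ℝ (Fin d), σ ^ 2 * ‖v‖ ^ 2 ≤ ∑ j, ⟪A j, v⟫ ^ 2)
    (hsol : ∀ j, ⟪A j, xstar⟫ = b j)
    (q : Fin (k + 1) → ℝ) (hq : ∀ ℓ, 0 ≤ q ℓ) (hq1 : ∑ ℓ, q ℓ = 1)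
    (e : Fin (k + 1) → Fin m → ℝ) (he0 : e 0 = 0) :
    ∑ ℓ, q ℓ *
        ∑ j, (‖A j‖ ^ 2 / ∑ j', ‖A j'‖ ^ 2) *
          ‖x + ((b j - ⟪A j, x⟫ + e ℓ j) / ‖A j‖ ^ 2) • A j - xstar‖ ^ 2
      ≤ (1 - σ ^ 2 / ∑ j', ‖A j'‖ ^ 2) * ‖x - xstar‖ ^ 2
        + (1 / ∑ j', ‖A j'‖ ^ 2) *
            ∑ ℓ ∈ Finset.univ.erase 0, q ℓ * ∑ j, e ℓ j ^ 2 := by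
  have hF : 0 < ∑ j, ‖A j‖ ^ 2 :=
    Finset.sum_pos (fun j _ => pow_pos (norm_pos_iff.mpr (hA j)) 2) ⟨⟨0, hm⟩, Finset.mem_univ _⟩
  have hstep (ℓ : Fin (k + 1)) (j : Fin m) :
      x + ((b j - ⟪A j, x⟫ + e ℓ j) / ‖A j‖ ^ 2) • A j - xstar
        = (x - xstar) + ((e ℓ j - ⟪A j, x - xstar⟫) / ‖A j‖ ^ 2) • A j := by
    rw [inner_sub_right, hsol, add_sub_right_comm,
      show b j - ⟪A j, x⟫ + e ℓ j = e ℓ j - (⟪A j, x⟫ - b j) by ring]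
  have herr : ∑ ℓ ∈ Finset.univ.erase 0, q ℓ * ∑ j, e ℓ j ^ 2 = ∑ ℓ, q ℓ * ∑ j, e ℓ j ^ 2 :=
    Finset.sum_erase _ (by simp [he0])
  simp_rw [hstep, sum_norm_sq_add_kaczmarz_step hA hF.ne', herr, sub_div, mul_add, mul_sub,
    Finset.sum_add_distrib, Finset.sum_sub_distrib, ← Finset.sum_mul, hq1, ← mul_div_assoc,
    ← Finset.sum_div]
  have hmin := div_le_div_of_nonneg_right (hσ (x - xstar)) hF.le
  rw [sub_mul, div_mul_eq_mul_div, one_div_mul_eq_div, one_mul, one_mul]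
  linarith
end

section
/- Let A ∈ ℝ^{d₁×d₂} with d₁ ≥ d₂, all rows A_j nonzero, smallest singular value σ_min(A) > 0, and α = 1 − σ_min(A)²/‖A‖_F² ∈ [0,1). Let b ∈ ℝ^{d₁} and x* ∈ ℝ^{d₂} satisfy A x* = b, let q_0, ..., q_k ≥ 0 with ∑_{ℓ=0}^{k} q_ℓ = 1, let e_0 = 0, e_1, ..., e_k ∈ ℝ^{d₁}, and fix x_0 ∈ ℝ^{d₂}. Consider the random sequence (x_i) defined on the product probability space of i.i.d. draws (j_1, ℓ_1), (j_2, ℓ_2), ... — where at each step the row index j is drawn with probability ‖A_j‖²/‖A‖_F² and independently the category index ℓ with probability q_ℓ — by x_{i+1} = x_i + ((b_{j_{i+1}} − ⟨A_{j_{i+1}}, x_i⟩ + e_{ℓ_{i+1}}(j_{i+1}))/‖A_{j_{i+1}}‖²) A_{j_{i+1}}ᵀ. Then for every i ≥ 0, 𝔼‖x_{i+1} − x*‖² ≤ α^{i+1} ‖x_0 − x*‖² + ((1 − α^{i+1})/(1 − α)) · (1/‖A‖_F²) ∑_{ℓ=1}^{k} q_ℓ ‖e_ℓ‖². -/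
open Finset
open scoped RealInnerProductSpace

/-- The random sequence of iterates: `iterSeq upd x0 i ω` is the result of applying the
update map `upd` successively with the draws `ω 0, ω 1, …, ω (i-1)`, starting from `x0`;
i.e. `x_i` as a function of the first `i` i.i.d. draws. -/
def iterSeq {σ E : Type*} (upd : σ → E → E) (x0 : E) : (i : ℕ) → (Fin i → σ) → E
  | 0, _ => x0
  | i + 1, ω => upd (ω (Fin.last i)) (iterSeq upd x0 i fun t => ω t.castSucc)

/-- If one random step satisfies the drift inequality `𝔼 f(upd s y) ≤ α f(y) + β`, then after `n`
independent steps `𝔼 f(x_n) ≤ αⁿ f(x_0) + β ∑_{m<n} αᵐ`. -/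
theorem sum_prod_mul_iterSeq_le {S E : Type*} [Fintype S] (upd : S → E → E) (p : S → ℝ)
    (hp : ∀ s, 0 ≤ p s) (hp1 : ∑ s, p s = 1) (f : E → ℝ) (α β : ℝ) (hα : 0 ≤ α)
    (hstep : ∀ y, ∑ s, p s * f (upd s y) ≤ α * f y + β) (x0 : E) (n : ℕ) :
    ∑ ω : Fin n → S, (∏ t, p (ω t)) * f (iterSeq upd x0 n ω)
      ≤ α ^ n * f x0 + β * ∑ m ∈ Finset.range n, α ^ m := by
  induction n with
  | zero => simp [iterSeq]
  | succ n ih =>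
    have hmass : ∑ ω : Fin n → S, ∏ t, p (ω t) = 1 := by
      rw [← Fintype.sum_pow, hp1, one_pow]
    have hsplit : ∑ ω : Fin (n + 1) → S, (∏ t, p (ω t)) * f (iterSeq upd x0 (n + 1) ω)
        = ∑ ω : Fin n → S, (∏ t, p (ω t)) * ∑ s, p s * f (upd s (iterSeq upd x0 n ω)) := by
      rw [← (Fin.snocEquiv fun _ => S).sum_comp, Fintype.sum_prod_type, Finset.sum_comm]
      refine Finset.sum_congr rfl fun ω _ => ?_
      rw [Finset.mul_sum]
      refine Finset.sum_congr rfl fun s _ => ?_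
      simp only [Fin.snocEquiv_apply, Fin.prod_univ_castSucc, iterSeq, Fin.snoc_castSucc,
        Fin.snoc_last]
      ring
    rw [hsplit]
    calc ∑ ω : Fin n → S, (∏ t, p (ω t)) * ∑ s, p s * f (upd s (iterSeq upd x0 n ω))
        ≤ ∑ ω : Fin n → S, (∏ t, p (ω t)) * (α * f (iterSeq upd x0 n ω) + β) :=
          Finset.sum_le_sum fun ω _ =>
            mul_le_mul_of_nonneg_left (hstep _) (Finset.prod_nonneg fun t _ => hp _)
      _ = α * (∑ ω : Fin n → S, (∏ t, p (ω t)) * f (iterSeq upd x0 n ω)) + β := by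
          simp only [mul_add, Finset.sum_add_distrib, ← Finset.sum_mul, hmass, one_mul,
            Finset.mul_sum]
          congr 1
          exact Finset.sum_congr rfl fun ω _ => by ring
      _ ≤ α * (α ^ n * f x0 + β * ∑ m ∈ Finset.range n, α ^ m) + β := by gcongr
      _ = α ^ (n + 1) * f x0 + β * ∑ m ∈ Finset.range (n + 1), α ^ m := by
          rw [Finset.sum_range_succ', pow_zero]
          simp only [pow_succ', ← Finset.mul_sum]
          ring

/-- The squared error after one Kaczmarz projection whose right-hand side is perturbed by `ε`. -/
theorem norm_sq_add_smul_sub {E : Type*} [NormedAddCommGroup E] [InnerProductSpace ℝ E]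
    (a x y : E) (ha : a ≠ 0) (ε : ℝ) :
    ‖y + ((⟪a, x⟫ - ⟪a, y⟫ + ε) / ‖a‖ ^ 2) • a - x‖ ^ 2
      = ‖y - x‖ ^ 2 + (ε ^ 2 - ⟪a, y - x⟫ ^ 2) / ‖a‖ ^ 2 := by
  have ha' : ‖a‖ ≠ 0 := norm_ne_zero_iff.mpr ha
  rw [add_sub_right_comm, norm_add_sq_real, inner_smul_right, norm_smul, mul_pow,
    Real.norm_eq_abs, sq_abs, real_inner_comm a (y - x), inner_sub_right]
  field_simp
  ring

/-- Expected squared error after one step of the perturbed randomized Kaczmarz method. -/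
theorem sum_mul_norm_sq_kaczmarz_step {ι κ E : Type*} [Fintype ι] [Fintype κ]
    [NormedAddCommGroup E] [InnerProductSpace ℝ E] (A : ι → E) (hA : ∀ j, A j ≠ 0)
    (hF : ∑ j, ‖A j‖ ^ 2 ≠ 0) (q : κ → ℝ) (hq1 : ∑ ℓ, q ℓ = 1) (e : κ → ι → ℝ) (x y : E) :
    ∑ s : ι × κ, (‖A s.1‖ ^ 2 / ∑ j, ‖A j‖ ^ 2) * q s.2 *
        ‖y + ((⟪A s.1, x⟫ - ⟪A s.1, y⟫ + e s.2 s.1) / ‖A s.1‖ ^ 2) • A s.1 - x‖ ^ 2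
      = ‖y - x‖ ^ 2 - (∑ j, ⟪A j, y - x⟫ ^ 2) / ∑ j, ‖A j‖ ^ 2
        + (1 / ∑ j, ‖A j‖ ^ 2) * ∑ ℓ, q ℓ * ∑ j, e ℓ j ^ 2 := by
  set F := ∑ j, ‖A j‖ ^ 2 with hFdef
  have hterm : ∀ ℓ j, (‖A j‖ ^ 2 / F) * q ℓ *
        ‖y + ((⟪A j, x⟫ - ⟪A j, y⟫ + e ℓ j) / ‖A j‖ ^ 2) • A j - x‖ ^ 2
      = q ℓ * ((‖A j‖ ^ 2 * (‖y - x‖ ^ 2 / F) - ⟪A j, y - x⟫ ^ 2 * (1 / F))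
        + (1 / F) * e ℓ j ^ 2) := fun ℓ j => by
    have ha : ‖A j‖ ≠ 0 := norm_ne_zero_iff.mpr (hA j)
    rw [norm_sq_add_smul_sub _ _ _ (hA j)]
    field_simp
    ring
  rw [Fintype.sum_prod_type_right]
  simp only [hterm, ← Finset.mul_sum, Finset.sum_add_distrib, Finset.sum_sub_distrib,
    ← Finset.sum_mul, mul_add, hq1, ← hFdef]
  rw [one_mul, mul_div_cancel₀ _ hF, mul_one_div, Finset.mul_sum]
  congr 1
  exact Finset.sum_congr rfl fun ℓ _ => by ring

/-- `A ∈ ℝ^{d₁×d₂}` with `d₁ ≥ d₂`, all rows nonzero, smallest singular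
value `σ > 0` (so `σ² ‖v‖² ≤ ∑_j ⟪A_j, v⟫² = ‖A v‖²` for all `v`), and
`α = 1 - σ²/‖A‖_F² ∈ [0, 1)`.  `A x* = b`, category probabilities `q_0, …, q_k ≥ 0` sum
to `1`, error vectors `e_0 = 0, e_1, …, e_k ∈ ℝ^{d₁}`, and `x_0` is fixed.  The random
iterates are `x_{i+1} = x_i + ((b_j - ⟪A_j, x_i⟫ + e_ℓ(j))/‖A_j‖²) A_jᵀ` where at each
step `(j, ℓ)` is drawn i.i.d. with `ℙ(j) = ‖A_j‖²/‖A‖_F²` and `ℙ(ℓ) = q_ℓ` independently;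
the expectation below is the sum over all draw sequences weighted by the product measure.
Then for every `i ≥ 0`,
`𝔼‖x_{i+1} - x*‖² ≤ α^{i+1} ‖x_0 - x*‖² + ((1 - α^{i+1})/(1 - α)) (1/‖A‖_F²) ∑_{ℓ=1}^k q_ℓ ‖e_ℓ‖²`. -/
theorem adversarial_kaczmarz_convergence
    (d₁ d₂ k : ℕ) (hd : d₂ ≤ d₁)
    (A : Fin d₁ → EuclideanSpace ℝ (Fin d₂)) (b : Fin d₁ → ℝ)
    (xstar x0 : EuclideanSpace ℝ (Fin d₂)) (σ : ℝ)
    (hA : ∀ j, A j ≠ 0) (hσpos : 0 < σ)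
    (hσ : ∀ v : EuclideanSpace ℝ (Fin d₂), σ ^ 2 * ‖v‖ ^ 2 ≤ ∑ j, ⟪A j, v⟫ ^ 2)
    (hα0 : 0 ≤ 1 - σ ^ 2 / ∑ j, ‖A j‖ ^ 2)
    (hsol : ∀ j, ⟪A j, xstar⟫ = b j)
    (q : Fin (k + 1) → ℝ) (hq : ∀ ℓ, 0 ≤ q ℓ) (hq1 : ∑ ℓ, q ℓ = 1)
    (e : Fin (k + 1) → Fin d₁ → ℝ) (he0 : e 0 = 0)
    (i : ℕ) :
    ∑ ω : Fin (i + 1) → Fin d₁ × Fin (k + 1),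
        (∏ t, (‖A (ω t).1‖ ^ 2 / ∑ j, ‖A j‖ ^ 2) * q (ω t).2) *
          ‖iterSeq
              (fun s y => y + ((b s.1 - ⟪A s.1, y⟫ + e s.2 s.1) / ‖A s.1‖ ^ 2) • A s.1)
              x0 (i + 1) ω - xstar‖ ^ 2
      ≤ (1 - σ ^ 2 / ∑ j, ‖A j‖ ^ 2) ^ (i + 1) * ‖x0 - xstar‖ ^ 2
        + ((1 - (1 - σ ^ 2 / ∑ j, ‖A j‖ ^ 2) ^ (i + 1)) /
              (1 - (1 - σ ^ 2 / ∑ j, ‖A j‖ ^ 2))) *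
            ((1 / ∑ j, ‖A j‖ ^ 2) * ∑ ℓ ∈ Finset.univ.erase 0, q ℓ * ∑ j, e ℓ j ^ 2) := by
  rcases Nat.eq_zero_or_pos d₁ with rfl | hd₁
  · simp
  set F := ∑ j, ‖A j‖ ^ 2 with hFdef
  have hF : 0 < F := Finset.sum_pos (fun j _ => pow_pos (norm_pos_iff.mpr (hA j)) 2)
    ⟨⟨0, hd₁⟩, Finset.mem_univ _⟩
  obtain rfl : b = fun j => ⟪A j, xstar⟫ := funext fun j => (hsol j).symm
  have herr : ∑ ℓ ∈ Finset.univ.erase 0, q ℓ * ∑ j, e ℓ j ^ 2 = ∑ ℓ, q ℓ * ∑ j, e ℓ j ^ 2 :=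
    Finset.sum_erase _ (by simp [he0])
  have hα1 : 1 - σ ^ 2 / F ≠ 1 := by
    have : 0 < σ ^ 2 / F := by positivity
    linarith
  rw [herr]
  refine (sum_prod_mul_iterSeq_le _ (fun s : Fin d₁ × Fin (k + 1) => ‖A s.1‖ ^ 2 / F * q s.2)
    (fun s => mul_nonneg (by positivity) (hq _)) ?_ (fun y => ‖y - xstar‖ ^ 2) _
    (1 / F * ∑ ℓ, q ℓ * ∑ j, e ℓ j ^ 2) hα0 (fun y => ?_) x0 (i + 1)).trans_eq ?_
  · simp only [Fintype.sum_prod_type, ← Finset.mul_sum, hq1, mul_one, ← Finset.sum_div]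
    exact div_self hF.ne'
  · refine (sum_mul_norm_sq_kaczmarz_step A hA hF.ne' q hq1 e xstar y).trans_le ?_
    have h := div_le_div_of_nonneg_right (hσ (y - xstar)) hF.le
    rw [mul_div_right_comm] at h
    rw [← hFdef, sub_mul, one_mul]
    gcongr
  · rw [geom_sum_eq hα1, ← neg_div_neg_eq (_ - 1), neg_sub, neg_sub, mul_comm (1 / F * _)]
end
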